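/- Let n ≥ 1, let b_{ik} ∈ ℚ for 1 ≤ k ≤ i ≤ n, set f^{b_i}_{i,2n+1−i} := Σ_{k=1}^{i} b_{ik}·(∏_{ℓ=i+1}^{2n+1−i} α^{B}_{k,ℓ})·x_k and R^{B} := ℝ[x_1,…,x_n]/(f^{b_1}_{1,2n},…,f^{b_n}_{n,n+1}), and assume R^{B} is Artinian (finite dimensional over ℝ). Fix for each i = 1,…,n a permutation w^{(i)} of {i+1, i+2, …, 2n+1−i}. Then the classes ∏_{i=1}^{n} α^{B}_{i,w^{(i)}(2n+1−i)}·α^{B}_{i,w^{(i)}(2n−i)}···α^{B}_{i,w^{(i)}(2n+1−i−m_i+1)}, indexed by tuples (m_1,…,m_n) with 0 ≤ m_i ≤ 2(n−i)+1 (an empty product being 1), form a basis of R^{B} as an ℝ-vector space. -/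

import Mathlib

open MvPolynomial

noncomputable section

/-- The variable `x_k` (1-indexed) of `ℝ[x_1,…,x_n]`. -/
def xv (n : ℕ) (k : ℕ) : MvPolynomial (Fin n) ℝ :=
  if h : 1 ≤ k ∧ k ≤ n then X ⟨k - 1, by omega⟩ else 0

/-- The type `B_n` root label `α^{B}_{i,j}`: `x_i − x_j` for `i+1 ≤ j ≤ n`, `x_i` for
`j = n+1`, and `x_i + x_{2n+2−j}` for `n+2 ≤ j ≤ 2n+1−i`. -/
def alB (n i j : ℕ) : MvPolynomial (Fin n) ℝ :=
  if j ≤ n then xv n i - xv n j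
  else if j = n + 1 then xv n i
  else xv n i + xv n (2 * n + 2 - j)

/-- The deformed polynomial
`f^{b_i}_{i,2n+1−i} = Σ_{k=1}^{i} b_{ik}·(∏_{ℓ=i+1}^{2n+1−i} α^{B}_{k,ℓ})·x_k`. -/
def fBdef (n : ℕ) (b : ℕ → ℕ → ℚ) (i : ℕ) : MvPolynomial (Fin n) ℝ :=
  ∑ k ∈ Finset.Icc 1 i,
    (b i k : ℝ) • ((∏ ℓ ∈ Finset.Icc (i + 1) (2 * n + 1 - i), alB n k ℓ) * xv n k)

/-- The ideal `(f^{b_1}_{1,2n}, …, f^{b_n}_{n,n+1})`, so that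
`R^{B} = ℝ[x_1,…,x_n]/IBdef n b`. -/
def IBdef (n : ℕ) (b : ℕ → ℕ → ℚ) : Ideal (MvPolynomial (Fin n) ℝ) :=
  Ideal.span ((fun i => fBdef n b i) '' Set.Icc 1 n)

/-- The class of `∏_{i=1}^{n} α^{B}_{i,w⁽ⁱ⁾(2n+1−i)}···α^{B}_{i,w⁽ⁱ⁾(2n+1−i−m_i+1)}`
in `R^{B}`. -/
def basB (n : ℕ) (b : ℕ → ℕ → ℚ) (w : ℕ → Equiv.Perm ℕ)
    (m : (i : Fin n) → Fin (2 * (n - (i.val + 1)) + 1 + 1)) :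
    MvPolynomial (Fin n) ℝ ⧸ IBdef n b :=
  Ideal.Quotient.mk (IBdef n b)
    (∏ i : Fin n, ∏ t ∈ Finset.range (m i : ℕ),
      alB n (i.val + 1) (w (i.val + 1) (2 * n + 1 - (i.val + 1) - t)))

namespace MvPolynomial

variable {σ K : Type*}

theorem homogeneousComponent_mul_of_isHomogeneous [CommSemiring K] {f : MvPolynomial σ K} {d : ℕ}
    (hf : f.IsHomogeneous d) (c : MvPolynomial σ K) (N : ℕ) :
    homogeneousComponent N (c * f) =
      if d ≤ N then homogeneousComponent (N - d) c * f else 0 := by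
  have hterm : ∀ i, homogeneousComponent N (homogeneousComponent i c * f) =
      if N = i + d then homogeneousComponent i c * f else 0 := fun i =>
    homogeneousComponent_of_mem ((homogeneousComponent_isHomogeneous i c).mul hf)
  conv_lhs => rw [← sum_homogeneousComponent c, Finset.sum_mul, map_sum]
  simp only [hterm]
  split_ifs with h
  · rw [Finset.sum_eq_single (N - d) (fun i _ hi => if_neg (by omega)) fun hN => ?_,
      if_pos (by omega)]
    rw [Finset.mem_range, not_lt] at hN
    rw [homogeneousComponent_eq_zero _ _ (by omega), zero_mul, ite_self]
  · exact Finset.sum_eq_zero fun i _ => if_neg (by omega)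

/-- If homogeneous polynomials `g j` span modulo the ideal generated by homogeneous polynomials
`f i` of positive degrees `d i`, then the products of the `g j` with monomials in the `f i` span
the polynomial ring, compatibly with degrees. -/
theorem IsHomogeneous.mem_span_mul_prod_pow [Field K] {τ ι : Type*} [Fintype τ]
    {f : τ → MvPolynomial σ K} {d : τ → ℕ} (hd : ∀ i, 0 < d i)
    (hf : ∀ i, (f i).IsHomogeneous (d i)) {g : ι → MvPolynomial σ K} {e : ι → ℕ}
    (hg : ∀ j, (g j).IsHomogeneous (e j))
    (hspan : ∀ p, ∃ q ∈ Submodule.span K (Set.range g), p - q ∈ Ideal.span (Set.range f))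
    (N : ℕ) {p : MvPolynomial σ K} (hp : p.IsHomogeneous N) :
    p ∈ Submodule.span K
      {r | ∃ j, ∃ a : τ → ℕ, ∑ i, d i * a i ≤ N ∧ r = g j * ∏ i, f i ^ a i} := by
  classical
  induction N using Nat.strong_induction_on generalizing p with
  | _ N ih =>
  obtain ⟨q, hq, hpq⟩ := hspan p
  obtain ⟨c, hc⟩ := Ideal.mem_span_range_iff_exists_fun.1 hpq
  have hsum : p = homogeneousComponent N q +
      ∑ i, homogeneousComponent N (c i * f i) := by
    rw [← map_sum, hc, ← map_add, add_sub_cancel, homogeneousComponent_eq_self hp]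
  rw [hsum]
  refine Submodule.add_mem _ ?_ (Submodule.sum_mem _ fun i _ => ?_)
  · have hle : Submodule.span K (Set.range g) ≤
        (Submodule.span K {r | ∃ j, ∃ a : τ → ℕ, ∑ i, d i * a i ≤ N ∧
          r = g j * ∏ i, f i ^ a i}).comap (homogeneousComponent N) := by
      rw [Submodule.span_le]
      rintro _ ⟨j, rfl⟩
      simp only [Submodule.comap_coe, Set.mem_preimage, SetLike.mem_coe]
      rw [homogeneousComponent_of_mem (hg j)]
      split_ifs
      · exact Submodule.subset_span ⟨j, 0, by simp, by simp⟩
      · exact Submodule.zero_mem _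
    exact hle hq
  · rw [homogeneousComponent_mul_of_isHomogeneous (hf i)]
    split_ifs with hdN
    · have h := ih (N - d i) (by have := hd i; omega)
        (homogeneousComponent_isHomogeneous (N - d i) (c i))
      refine (Submodule.span_le (p := Submodule.comap (LinearMap.mulRight K (f i))
        (Submodule.span K {r | ∃ j, ∃ a : τ → ℕ, ∑ i, d i * a i ≤ N ∧
          r = g j * ∏ i, f i ^ a i}))).2 ?_ h
      rintro _ ⟨j, a, ha, rfl⟩
      refine Submodule.subset_span ⟨j, a + Pi.single i 1, ?_, ?_⟩
      · simp only [Pi.add_apply, mul_add, Finset.sum_add_distrib, Pi.single_apply, mul_ite,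
          mul_one, mul_zero, Finset.sum_ite_eq', Finset.mem_univ, if_true]
        omega
      · simp only [Pi.add_apply, pow_add, Finset.prod_mul_distrib, Pi.single_apply, pow_ite,
          pow_one, pow_zero, Finset.prod_ite_eq', Finset.mem_univ, if_true,
          LinearMap.mulRight_apply, mul_assoc]
    · exact Submodule.zero_mem _

/-- The exponent vectors of weighted degree at most `D`, for positive weights `d`. -/
def weightedSimplex {τ : Type*} [Fintype τ] [DecidableEq τ] (d : τ → ℕ) (D : ℕ) :
    Finset (τ → ℕ) :=
  {a ∈ Fintype.piFinset fun _ => Finset.range (D + 1) | ∑ i, d i * a i ≤ D}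

section Counting

variable {τ : Type*} [Fintype τ] [DecidableEq τ] {d : τ → ℕ}

theorem mem_weightedSimplex (hd : ∀ i, 0 < d i) {D : ℕ} {a : τ → ℕ} :
    a ∈ weightedSimplex d D ↔ ∑ i, d i * a i ≤ D := by
  simp only [weightedSimplex, Finset.mem_filter, Fintype.mem_piFinset, Finset.mem_range,
    and_iff_right_iff_imp]
  intro h i
  have h1 : d i * a i ≤ ∑ i, d i * a i :=
    Finset.single_le_sum (f := fun i => d i * a i) (fun _ _ => Nat.zero_le _) (Finset.mem_univ i)
  have h2 : a i ≤ d i * a i := Nat.le_mul_of_pos_left _ (hd i)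
  omega

theorem card_weightedSimplex_le (D : ℕ) :
    (weightedSimplex d D).card ≤ (D + 1) ^ Fintype.card τ := by
  refine (Finset.card_filter_le _ _).trans ?_
  simp [Fintype.card_piFinset]

theorem card_weightedSimplex_mul_prod_le (hd : ∀ i, 0 < d i) (D : ℕ) :
    (weightedSimplex d D).card * ∏ i, d i ≤
      (weightedSimplex (fun _ : τ => 1) (D + ∑ i, d i)).card := by
  have hP : ∏ i, d i = (Fintype.piFinset fun i => Finset.range (d i)).card := by
    simp [Fintype.card_piFinset]
  rw [hP, ← Finset.card_product]
  refine Finset.card_le_card_of_injOn (fun p i => p.2 i + d i * p.1 i) ?_ ?_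
  · rintro ⟨a, r⟩ h
    simp only [Finset.coe_product, Set.mem_prod, Finset.mem_coe, mem_weightedSimplex hd,
      Fintype.mem_piFinset, Finset.mem_range] at h
    simp only [Finset.mem_coe, mem_weightedSimplex (fun _ => one_pos), one_mul,
      Finset.sum_add_distrib]
    have := Finset.sum_le_sum (s := Finset.univ) fun i _ => (h.2 i).le
    omega
  · rintro ⟨a, r⟩ h ⟨a', r'⟩ h' heq
    simp only [Finset.coe_product, Set.mem_prod, Finset.mem_coe, mem_weightedSimplex hd,
      Fintype.mem_piFinset, Finset.mem_range] at h h'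
    have hi := fun i => congrFun heq i
    simp only at hi
    have hr : r = r' := by
      funext i
      have := congrArg (· % d i) (hi i)
      simpa [Nat.mod_eq_of_lt (h.2 i), Nat.mod_eq_of_lt (h'.2 i)] using this
    subst hr
    have ha : a = a' := by
      funext i
      exact Nat.eq_of_mul_eq_mul_left (hd i) (by simpa using hi i)
    rw [ha]

/-- A positive function of polynomial growth cannot grow by a fixed factor `P / M > 1` on each
step of fixed length. -/
theorem le_of_mul_le_mul_of_poly_growth {h : ℕ → ℕ} {P M c k : ℕ} (h0 : 0 < h 0)
    (hk : ∀ D, h D ≤ (D + 1) ^ k) (hPM : ∀ D, P * h D ≤ M * h (D + c)) : P ≤ M := by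
  by_contra! hlt
  have hM : 0 < M := by
    rcases Nat.eq_zero_or_pos M with rfl | hM
    · have := hPM 0
      have : 0 < P * h 0 := Nat.mul_pos hlt h0
      omega
    · exact hM
  have hiter : ∀ t : ℕ, P ^ t ≤ M ^ t * h (t * c) := by
    intro t
    induction t with
    | zero => simpa [Nat.one_le_iff_ne_zero] using h0.ne'
    | succ t ih =>
      calc P ^ (t + 1) = P * P ^ t := pow_succ' _ _
        _ ≤ P * (M ^ t * h (t * c)) := Nat.mul_le_mul_left _ ih
        _ = M ^ t * (P * h (t * c)) := by ring
        _ ≤ M ^ t * (M * h (t * c + c)) := Nat.mul_le_mul_left _ (hPM _)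
        _ = M ^ (t + 1) * h ((t + 1) * c) := by rw [Nat.succ_mul]; ring
  have hr : (1 : ℝ) < P / M := by
    rw [one_lt_div (by exact_mod_cast hM)]
    exact_mod_cast hlt
  have hbound : ∀ t : ℕ, 1 ≤ t → (1 : ℝ) ≤ ((c : ℝ) + 1) ^ k * ((t : ℝ) ^ k / (P / M) ^ t) := by
    intro t ht
    have h1 : P ^ t ≤ M ^ t * ((c + 1) * t) ^ k :=
      (hiter t).trans (Nat.mul_le_mul_left _ ((hk _).trans (Nat.pow_le_pow_left (by nlinarith) _)))
    have h2 : (P : ℝ) ^ t ≤ M ^ t * ((c + 1) * t) ^ k := by exact_mod_cast h1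
    have hMt : (0 : ℝ) < (M : ℝ) ^ t := by positivity
    rw [← mul_div_assoc, ← mul_pow, one_le_div (by positivity), div_pow, div_le_iff₀ hMt]
    linarith
  have hlim := (tendsto_pow_const_div_const_pow_of_one_lt k hr).const_mul (((c : ℝ) + 1) ^ k)
  rw [mul_zero] at hlim
  have := ge_of_tendsto hlim (Filter.eventually_atTop.2 ⟨1, hbound⟩)
  norm_num at this

end Counting

/-- A finite-dimensional quotient of a polynomial ring by as many homogeneous polynomials as there
are variables has dimension at least the product of the degrees. -/
theorem prod_degree_le_finrank_quotient [Field K] [Fintype σ] {f : σ → MvPolynomial σ K}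
    {d : σ → ℕ} (hd : ∀ i, 0 < d i) (hf : ∀ i, (f i).IsHomogeneous (d i))
    [Module.Finite K (MvPolynomial σ K ⧸ Ideal.span (Set.range f))] :
    ∏ i, d i ≤ Module.finrank K (MvPolynomial σ K ⧸ Ideal.span (Set.range f)) := by
  classical
  set I := Ideal.span (Set.range f)
  let π : MvPolynomial σ K →ₗ[K] MvPolynomial σ K ⧸ I := (Ideal.Quotient.mkₐ K I).toLinearMap
  have hπ : Function.Surjective π := Ideal.Quotient.mk_surjective
  obtain ⟨B, hB, hBspan, hBli⟩ := exists_linearIndependent K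
    (Set.range fun s : σ →₀ ℕ => π (monomial s 1))
  have htop : Submodule.span K B = ⊤ := by
    rw [hBspan, Set.range_comp' π, Submodule.span_image]
    have : Submodule.span K (Set.range fun s : σ →₀ ℕ => monomial s (1 : K)) = ⊤ := by
      have := (basisMonomials σ K).span_eq
      rwa [coe_basisMonomials] at this
    rw [this, Submodule.map_top, LinearMap.range_eq_top.2 hπ]
  have : Fintype B := hBli.setFinite.fintype
  have hcard : Module.finrank K (MvPolynomial σ K ⧸ I) = Fintype.card B := by
    have b := Module.Basis.mk hBli (by simp [htop])
    exact Module.finrank_eq_card_basis b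
  rw [hcard]
  choose s hs using fun v : B => hB v.2
  let g : B → MvPolynomial σ K := fun v => monomial (s v) 1
  have hg : ∀ v, (g v).IsHomogeneous (s v).degree := fun v => isHomogeneous_monomial _ rfl
  have hspan : ∀ p, ∃ q ∈ Submodule.span K (Set.range g), p - q ∈ I := by
    intro p
    have hp : π p ∈ (Submodule.span K (Set.range g)).map π := by
      rw [← Submodule.span_image, ← Set.range_comp]
      have : π ∘ g = ((↑) : B → _) := _root_.funext hs
      rw [this, Subtype.range_coe, htop]
      trivial
    obtain ⟨q, hq, hqp⟩ := hp
    exact ⟨q, hq, Ideal.Quotient.eq.1 hqp.symm⟩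
  refine le_of_mul_le_mul_of_poly_growth
    (h := fun D => (weightedSimplex (fun _ : σ => 1) D).card) (c := ∑ i, d i)
    (Finset.card_pos.2 ⟨0, ?_⟩) card_weightedSimplex_le fun D => ?_
  · rw [mem_weightedSimplex (fun _ => one_pos)]
    simp
  have hmono : (weightedSimplex (fun _ : σ => 1) D).card ≤
      Fintype.card B * (weightedSimplex d D).card := by
    let v : weightedSimplex (fun _ : σ => 1) D → MvPolynomial σ K :=
      fun a => monomial (Finsupp.equivFunOnFinite.symm a.1) 1
    have hv : LinearIndependent K v := by
      have h := (basisMonomials σ K).linearIndependent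
      rw [coe_basisMonomials] at h
      exact h.comp (fun a : weightedSimplex (fun _ : σ => 1) D =>
        Finsupp.equivFunOnFinite.symm a.1)
        (Finsupp.equivFunOnFinite.symm.injective.comp Subtype.val_injective)
    let T : Finset (MvPolynomial σ K) :=
      (Finset.univ ×ˢ weightedSimplex d D).image fun q => g q.1 * ∏ i, f i ^ q.2 i
    have hvT : Set.range v ≤ Submodule.span K (T : Set (MvPolynomial σ K)) := by
      rintro _ ⟨⟨a, ha⟩, rfl⟩
      rw [mem_weightedSimplex (fun _ => one_pos)] at ha
      simp only [one_mul] at ha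
      have hhom : (v ⟨a, by rw [mem_weightedSimplex (fun _ => one_pos)]; simpa using ha⟩).IsHomogeneous
          (∑ i, a i) := by
        refine isHomogeneous_monomial _ ?_
        rw [Finsupp.degree_eq_sum]
        rfl
      refine Submodule.span_mono ?_ (hhom.mem_span_mul_prod_pow hd hf hg hspan)
      rintro _ ⟨j, e, he, rfl⟩
      simp only [T, Finset.coe_image, Set.mem_image, Finset.mem_coe, Finset.mem_product,
        Finset.mem_univ, true_and, Prod.exists, mem_weightedSimplex hd]
      exact ⟨j, e, he.trans ha, rfl⟩
    have h := linearIndependent_le_span' v hv _ hvT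
    simp only [Cardinal.mk_fintype, Nat.cast_le, Fintype.card_coe, Finset.coe_sort_coe] at h
    refine h.trans (Finset.card_image_le.trans ?_)
    rw [Finset.card_product, Finset.card_univ]
  calc (∏ i, d i) * (weightedSimplex (fun _ : σ => 1) D).card
      ≤ (∏ i, d i) * (Fintype.card B * (weightedSimplex d D).card) := Nat.mul_le_mul_left _ hmono
    _ = Fintype.card B * ((weightedSimplex d D).card * ∏ i, d i) := by ring
    _ ≤ _ := Nat.mul_le_mul_left _ (card_weightedSimplex_mul_prod_le hd D)

/-- None of as many homogeneous polynomials of positive degree as there are variables vanishes if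
the quotient by them is finite dimensional. -/
theorem ne_zero_of_finite_quotient [Field K] [Fintype σ] {f : σ → MvPolynomial σ K}
    {d : σ → ℕ} (hd : ∀ i, 0 < d i) (hf : ∀ i, (f i).IsHomogeneous (d i))
    [Module.Finite K (MvPolynomial σ K ⧸ Ideal.span (Set.range f))] (i : σ) : f i ≠ 0 := by
  classical
  intro hi
  let M := Module.finrank K (MvPolynomial σ K ⧸ Ideal.span (Set.range f))
  have hd' : ∀ j, 0 < Function.update d i (M + 1) j := fun j => by
    rcases eq_or_ne j i with rfl | h
    · simp
    · simpa [h] using hd j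
  have h := prod_degree_le_finrank_quotient hd' (f := f) fun j => by
    rcases eq_or_ne j i with rfl | h
    · rw [hi]
      exact isHomogeneous_zero _ _ _
    · simpa [h] using hf j
  have h2 : Function.update d i (M + 1) i ≤ ∏ j, Function.update d i (M + 1) j :=
    Nat.le_of_dvd (Finset.prod_pos fun j _ => hd' j) (Finset.dvd_prod_of_mem _ (Finset.mem_univ i))
  rw [Function.update_self] at h2
  omega

end MvPolynomial

section RootsB

variable {A : Type*} [CommRing A]

/-- The root `α^{B}_{i,j}` evaluated at a sequence `x` of ring elements. -/
def rootB (n : ℕ) (x : ℕ → A) (i j : ℕ) : A :=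
  if j ≤ n then x i - x j else if j = n + 1 then x i else x i + x (2 * n + 2 - j)

/-- The product `x_k² ∏_{j=i+1}^n (x_k² - x_j²)`. -/
def rootBSqProd (n : ℕ) (x : ℕ → A) (i k : ℕ) : A :=
  x k ^ 2 * ∏ j ∈ Finset.Icc (i + 1) n, (x k ^ 2 - x j ^ 2)

theorem map_rootB {A' : Type*} [CommRing A'] (φ : A →+* A') (n : ℕ) (x : ℕ → A) (i j : ℕ) :
    φ (rootB n x i j) = rootB n (fun k => φ (x k)) i j := by
  unfold rootB
  split_ifs <;> simp

theorem map_rootBSqProd {A' : Type*} [CommRing A'] (φ : A →+* A') (n : ℕ) (x : ℕ → A)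
    (i k : ℕ) : φ (rootBSqProd n x i k) = rootBSqProd n (fun k => φ (x k)) i k := by
  simp [rootBSqProd]

theorem rootBSqProd_eq_of_sq_eq {n : ℕ} {x : ℕ → A} {k l : ℕ} (h : x k ^ 2 = x l ^ 2) (i : ℕ) :
    rootBSqProd n x i k = rootBSqProd n x i l := by
  simp [rootBSqProd, h]

theorem rootBSqProd_eq_zero {n : ℕ} {x : ℕ → A} {k : ℕ} (h : x k = 0) (i : ℕ) :
    rootBSqProd n x i k = 0 := by
  simp [rootBSqProd, h]

theorem rootBSqProd_eq_zero_of_sq_eq {n : ℕ} {x : ℕ → A} {i k l : ℕ} (hl : l ∈ Finset.Icc (i + 1) n)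
    (h : x k ^ 2 = x l ^ 2) : rootBSqProd n x i k = 0 := by
  rw [rootBSqProd, Finset.prod_eq_zero hl (by rw [h, sub_self]), mul_zero]

theorem prod_rootB_mul_self (n : ℕ) (x : ℕ → A) {i : ℕ} (hi : i ≤ n) (k : ℕ) :
    (∏ l ∈ Finset.Icc (i + 1) (2 * n + 1 - i), rootB n x k l) * x k = rootBSqProd n x i k := by
  obtain ⟨r, hr⟩ : ∃ r, i + r = n := ⟨n - i, by omega⟩
  induction r generalizing i with
  | zero =>
    obtain rfl : i = n := by omega
    have : 2 * i + 1 - i = i + 1 := by omega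
    simp [this, rootBSqProd, rootB, sq]
  | succ r ih =>
    have h1 : Finset.Icc (i + 1) (2 * n + 1 - i) =
        insert (i + 1) (insert (2 * n + 1 - i) (Finset.Icc (i + 1 + 1) (2 * n + 1 - (i + 1)))) := by
      ext a
      simp only [Finset.mem_Icc, Finset.mem_insert]
      omega
    have h2 : Finset.Icc (i + 1) n = insert (i + 1) (Finset.Icc (i + 1 + 1) n) := by
      ext a
      simp only [Finset.mem_Icc, Finset.mem_insert]
      omega
    have h3 : rootB n x k (i + 1) = x k - x (i + 1) := by
      rw [rootB, if_pos (by omega)]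
    have h4 : rootB n x k (2 * n + 1 - i) = x k + x (i + 1) := by
      rw [rootB, if_neg (by omega), if_neg (by omega)]
      congr 2
      omega
    have ih' := ih (i := i + 1) (by omega) (by omega)
    rw [rootBSqProd] at ih' ⊢
    rw [h1, h2, Finset.prod_insert (by simp only [Finset.mem_Icc, Finset.mem_insert]; omega),
      Finset.prod_insert (by simp only [Finset.mem_Icc]; omega),
      Finset.prod_insert (by simp only [Finset.mem_Icc]; omega), h3, h4]
    linear_combination (x k - x (i + 1)) * (x k + x (i + 1)) * ih'

theorem rootB_eq_cases {n : ℕ} (x : ℕ → A) {p l : ℕ} (hl : l ∈ Finset.Icc (p + 1) (2 * n + 1 - p)) :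
    rootB n x p l = x p ∨ ∃ j ∈ Finset.Icc (p + 1) n,
      rootB n x p l = x p - x j ∨ rootB n x p l = x p + x j := by
  rw [Finset.mem_Icc] at hl
  unfold rootB
  split_ifs with h1 h2
  · exact Or.inr ⟨l, Finset.mem_Icc.2 ⟨hl.1, h1⟩, Or.inl rfl⟩
  · exact Or.inl rfl
  · exact Or.inr ⟨2 * n + 2 - l, Finset.mem_Icc.2 (by omega), Or.inr rfl⟩

theorem prod_range_perm_Icc {n p : ℕ} (hp : p ≤ n) {w : Equiv.Perm ℕ}
    (hw : ∀ j ∈ Finset.Icc (p + 1) (2 * n + 1 - p), w j ∈ Finset.Icc (p + 1) (2 * n + 1 - p))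
    (F : ℕ → A) :
    ∏ t ∈ Finset.range (2 * (n - p) + 1), F (w (2 * n + 1 - p - t)) =
      ∏ l ∈ Finset.Icc (p + 1) (2 * n + 1 - p), F l := by
  have hmap : (Finset.Icc (p + 1) (2 * n + 1 - p)).map w.toEmbedding =
      Finset.Icc (p + 1) (2 * n + 1 - p) := by
    refine Finset.eq_of_subset_of_card_le (fun a ha => ?_) (by simp)
    obtain ⟨j, hj, rfl⟩ := Finset.mem_map.1 ha
    exact hw j hj
  conv_rhs => rw [← hmap, Finset.prod_map]
  refine Finset.prod_nbij' (fun t => 2 * n + 1 - p - t) (fun j => 2 * n + 1 - p - j) ?_ ?_ ?_ ?_ ?_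
  all_goals simp only [Finset.mem_range, Finset.mem_Icc, Equiv.coe_toEmbedding]
  all_goals intros
  all_goals first | omega | trivial

/-- All the numbers `b_{ii} + ∑_{k ∈ s} b_{ik}` with `p ≤ i ≤ n` and `s ⊆ {p, …, i - 1}` are
nonzero. -/
def PartialRowSumsNeZero (n p : ℕ) (b : ℕ → ℕ → ℝ) : Prop :=
  ∀ i ∈ Finset.Icc p n, ∀ s ⊆ Finset.Ico p i, b i i + ∑ k ∈ s, b i k ≠ 0

/-- Imposing `x_p = 0` or `x_p = ± x_j` with `p < j` turns the relations in `x_p, …, x_n` into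
relations of the same form in `x_{p+1}, …, x_n`. -/
theorem exists_coeff_eliminating [Algebra ℝ A] {n p : ℕ} {x : ℕ → A} {b : ℕ → ℕ → ℝ}
    (hb : PartialRowSumsNeZero n p b)
    (hrel : ∀ i ∈ Finset.Icc (p + 1) n, ∑ k ∈ Finset.Icc p i, b i k • rootBSqProd n x i k = 0)
    (hx : x p = 0 ∨ ∃ j ∈ Finset.Icc (p + 1) n, x p ^ 2 = x j ^ 2) :
    ∃ b' : ℕ → ℕ → ℝ, PartialRowSumsNeZero n (p + 1) b' ∧
      ∀ i ∈ Finset.Icc (p + 1) n,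
        ∑ k ∈ Finset.Icc (p + 1) i, b' i k • rootBSqProd n x i k = 0 := by
  have hsplit : ∀ i ∈ Finset.Icc (p + 1) n, Finset.Icc p i = insert p (Finset.Icc (p + 1) i) := by
    intro i hi
    ext a
    simp only [Finset.mem_Icc, Finset.mem_insert] at hi ⊢
    omega
  have hrel' : ∀ i ∈ Finset.Icc (p + 1) n, b i p • rootBSqProd n x i p +
      ∑ k ∈ Finset.Icc (p + 1) i, b i k • rootBSqProd n x i k = 0 := by
    intro i hi
    have := hrel i hi
    rwa [hsplit i hi, Finset.sum_insert (by simp)] at this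
  rcases hx with hx | ⟨j, hj, hx⟩
  · refine ⟨b, fun i hi s hs => hb i ?_ s (hs.trans ?_), fun i hi => ?_⟩
    · simp only [Finset.mem_Icc] at hi ⊢
      omega
    · exact Finset.Ico_subset_Ico_left (by omega)
    · simpa [rootBSqProd_eq_zero hx] using hrel' i hi
  · refine ⟨fun i k => b i k + if k = j then b i p else 0, fun i hi s hs => ?_, fun i hi => ?_⟩
    · have hi' : i ∈ Finset.Icc p n := by
        simp only [Finset.mem_Icc] at hi ⊢
        omega
      have hs' : s ⊆ Finset.Ico p i := hs.trans (Finset.Ico_subset_Ico_left (by omega))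
      have hps : p ∉ s := fun h => by simpa using hs h
      have his : i ∉ s := fun h => by simpa using hs h
      have hins : insert p s ⊆ Finset.Ico p i := by
        refine Finset.insert_subset ?_ hs'
        simp only [Finset.mem_Icc, Finset.mem_Ico] at hi ⊢
        omega
      simp only [Finset.sum_add_distrib, Finset.sum_ite_eq']
      by_cases hij : i = j
      · subst hij
        rw [if_pos rfl, if_neg his, add_zero]
        have := hb i hi' _ hins
        rw [Finset.sum_insert hps] at this
        convert this using 1
        ring
      · rw [if_neg hij, add_zero]
        by_cases hjs : j ∈ s
        · rw [if_pos hjs]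
          have := hb i hi' _ hins
          rw [Finset.sum_insert hps] at this
          convert this using 1
          ring
        · rw [if_neg hjs, add_zero]
          exact hb i hi' s hs'
    · rw [← hrel' i hi]
      simp only [add_smul, Finset.sum_add_distrib, ite_smul, zero_smul, Finset.sum_ite_eq']
      rw [add_comm]
      congr 1
      by_cases hji : j ≤ i
      · rw [if_pos (Finset.mem_Icc.2 ⟨(Finset.mem_Icc.1 hj).1, hji⟩), rootBSqProd_eq_of_sq_eq hx]
      · rw [if_neg (fun h => hji (Finset.mem_Icc.1 h).2), rootBSqProd_eq_zero_of_sq_eq _ hx,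
          smul_zero]
        simp only [Finset.mem_Icc] at hj ⊢
        omega

/-- The products `∏_{i=p}^n ∏_{t < m_i} α_{i, w_i(2n+1-i-t)}` with `m_i ≤ 2(n-i)+1`. -/
def rootBProducts (n : ℕ) (w : ℕ → Equiv.Perm ℕ) (x : ℕ → A) (p : ℕ) : Set A :=
  {y | ∃ m : ℕ → ℕ, (∀ i ∈ Finset.Icc p n, m i ≤ 2 * (n - i) + 1) ∧
    y = ∏ i ∈ Finset.Icc p n, ∏ t ∈ Finset.range (m i), rootB n x i (w i (2 * n + 1 - i - t))}

theorem image_rootBProducts {A' : Type*} [CommRing A'] (φ : A →+* A') (n : ℕ)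
    (w : ℕ → Equiv.Perm ℕ) (x : ℕ → A) (p : ℕ) :
    φ '' rootBProducts n w x p = rootBProducts n w (fun k => φ (x k)) p := by
  ext y
  constructor
  · rintro ⟨_, ⟨m, hm, rfl⟩, rfl⟩
    exact ⟨m, hm, by simp [map_prod, map_rootB]⟩
  · rintro ⟨m, hm, rfl⟩
    exact ⟨_, ⟨m, hm, rfl⟩, by simp [map_prod, map_rootB]⟩

theorem prod_mul_mem_rootBProducts {n p : ℕ} (hp : p ≤ n) {w : ℕ → Equiv.Perm ℕ} {x : ℕ → A}
    {s : ℕ} (hs : s ≤ 2 * (n - p) + 1) {y : A} (hy : y ∈ rootBProducts n w x (p + 1)) :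
    (∏ t ∈ Finset.range s, rootB n x p (w p (2 * n + 1 - p - t))) * y ∈ rootBProducts n w x p := by
  obtain ⟨m, hm, rfl⟩ := hy
  have hIcc : Finset.Icc p n = insert p (Finset.Icc (p + 1) n) := by
    ext a
    simp only [Finset.mem_Icc, Finset.mem_insert]
    omega
  refine ⟨Function.update m p s, fun i hi => ?_, ?_⟩
  · rcases eq_or_ne i p with rfl | h
    · simpa using hs
    · rw [Function.update_of_ne h]
      refine hm i ?_
      simp only [Finset.mem_Icc] at hi ⊢
      omega
  · rw [hIcc, Finset.prod_insert (by simp), Function.update_self]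
    congr 1
    refine Finset.prod_congr rfl fun i hi => ?_
    rw [Function.update_of_ne]
    rw [Finset.mem_Icc] at hi
    omega

/-- If every element decomposes as `u + L_t c` with `u` in a set `U` for each of finitely many
elements `L_0, …, L_N` whose product is zero, then any submodule containing all the
`L_0 ⋯ L_{s-1} u` with `s ≤ N` and `u ∈ U` is everything. -/
theorem eq_top_of_forall_prod_mul_mem [Algebra ℝ A] {N : ℕ} {L : ℕ → A} {U : Submodule ℝ A}
    {V : Submodule ℝ A} (hprod : ∏ t ∈ Finset.range (N + 1), L t = 0)
    (hdecomp : ∀ t ≤ N, ∀ a, ∃ u ∈ U, ∃ c, a = u + L t * c)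
    (hmem : ∀ s ≤ N, ∀ u ∈ U, (∏ t ∈ Finset.range s, L t) * u ∈ V) : V = ⊤ := by
  have key : ∀ r s, s + r = N + 1 → ∀ a, (∏ t ∈ Finset.range s, L t) * a ∈ V := by
    intro r
    induction r with
    | zero =>
      intro s hs a
      obtain rfl : s = N + 1 := by omega
      rw [hprod, zero_mul]
      exact V.zero_mem
    | succ r ih =>
      intro s hs a
      obtain ⟨u, hu, c, rfl⟩ := hdecomp s (by omega) a
      rw [mul_add, ← mul_assoc, ← Finset.prod_range_succ]
      exact V.add_mem (hmem s (by omega) u hu) (ih (s + 1) (by omega) c)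
  refine eq_top_iff.2 fun a _ => ?_
  simpa using key (N + 1) 0 (by omega) a

end RootsB

theorem span_rootBProducts_eq_top {n : ℕ} {w : ℕ → Equiv.Perm ℕ}
    (hw : ∀ i ∈ Finset.Icc 1 n, ∀ j ∈ Finset.Icc (i + 1) (2 * n + 1 - i),
      w i j ∈ Finset.Icc (i + 1) (2 * n + 1 - i))
    (r : ℕ) {p : ℕ} (hp : 1 ≤ p) (hpr : p + r = n + 1) {A : Type*} [CommRing A] [Algebra ℝ A]
    {x : ℕ → A} {b : ℕ → ℕ → ℝ} (hb : PartialRowSumsNeZero n p b)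
    (hgen : Algebra.adjoin ℝ (x '' Set.Icc p n) = ⊤)
    (hrel : ∀ i ∈ Finset.Icc p n, ∑ k ∈ Finset.Icc p i, b i k • rootBSqProd n x i k = 0) :
    Submodule.span ℝ (rootBProducts n w x p) = ⊤ := by
  induction r generalizing p A b with
  | zero =>
    obtain rfl : p = n + 1 := by omega
    have hset : rootBProducts n w x (n + 1) = {1} := by
      ext y
      simp only [rootBProducts, Finset.Icc_eq_empty_of_lt (Nat.lt_succ_self n)]
      simp
    rw [Set.Icc_eq_empty (by omega), Set.image_empty, Algebra.adjoin_empty] at hgen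
    rw [hset, ← Submodule.one_eq_span, ← Algebra.toSubmodule_bot, hgen, Algebra.top_toSubmodule]
  | succ r ih =>
    have hpn : p ≤ n := by omega
    have hpIcc : p ∈ Finset.Icc p n := Finset.mem_Icc.2 ⟨le_rfl, hpn⟩
    have hwp := hw p (Finset.mem_Icc.2 ⟨hp, hpn⟩)
    have hdecomp : ∀ L : A, (L = x p ∨ ∃ j ∈ Finset.Icc (p + 1) n, L = x p - x j ∨ L = x p + x j) →
        ∀ a, ∃ u ∈ Submodule.span ℝ (rootBProducts n w x (p + 1)), ∃ c, a = u + L * c := by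
      intro L hL a
      let π : A →ₐ[ℝ] A ⧸ Ideal.span {L} := Ideal.Quotient.mkₐ ℝ _
      have hπ : Function.Surjective π := Ideal.Quotient.mk_surjective
      have hπL : π L = 0 := Ideal.Quotient.eq_zero_iff_mem.2 (Ideal.mem_span_singleton_self L)
      have hxp : π (x p) = 0 ∨
          ∃ j ∈ Finset.Icc (p + 1) n, π (x p) = π (x j) ∨ π (x p) = - π (x j) := by
        rcases hL with rfl | ⟨j, hj, rfl | rfl⟩
        · exact Or.inl hπL
        · exact Or.inr ⟨j, hj, Or.inl (by rwa [map_sub, sub_eq_zero] at hπL)⟩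
        · exact Or.inr ⟨j, hj, Or.inr (by rwa [map_add, add_eq_zero_iff_eq_neg] at hπL)⟩
      have hgen' : Algebra.adjoin ℝ ((fun k => π (x k)) '' Set.Icc (p + 1) n) = ⊤ := by
        have h1 : Algebra.adjoin ℝ (π '' (x '' Set.Icc p n)) = ⊤ := by
          rw [← AlgHom.map_adjoin, hgen, Algebra.map_top, AlgHom.range_eq_top]
          exact hπ
        refine eq_top_iff.2 (h1 ▸ Algebra.adjoin_le ?_)
        have hmem : ∀ k ∈ Finset.Icc (p + 1) n,
            π (x k) ∈ Algebra.adjoin ℝ ((fun k => π (x k)) '' Set.Icc (p + 1) n) :=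
          fun k hk => Algebra.subset_adjoin ⟨k, Finset.mem_Icc.1 hk, rfl⟩
        rintro _ ⟨_, ⟨k, hk, rfl⟩, rfl⟩
        rcases eq_or_ne k p with rfl | hkp
        · rcases hxp with h | ⟨j, hj, h | h⟩
          · rw [h]
            exact Subalgebra.zero_mem _
          · rw [h]
            exact hmem j hj
          · rw [h]
            exact Subalgebra.neg_mem _ (hmem j hj)
        · refine hmem k (Finset.mem_Icc.2 ⟨?_, hk.2⟩)
          have := hk.1
          omega
      obtain ⟨b', hb', hrel'⟩ := exists_coeff_eliminating (x := fun k => π (x k)) hb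
        (fun i hi => by
          have h := congrArg π (hrel i (Finset.Icc_subset_Icc_left (Nat.le_succ p) hi))
          simpa only [map_sum, map_smul, map_zero, ← RingHom.coe_coe π, map_rootBSqProd] using h)
        (hxp.imp_right fun ⟨j, hj, h⟩ => ⟨j, hj, by rcases h with h | h <;> simp [h]⟩)
      have htop := ih (by omega) (by omega) hb' hgen' hrel'
      have ha : π a ∈ (Submodule.span ℝ (rootBProducts n w x (p + 1))).map π.toLinearMap := by
        rw [← Submodule.span_image]
        have := image_rootBProducts (π : A →+* A ⧸ Ideal.span {L}) n w x (p + 1)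
        simp only [RingHom.coe_coe] at this
        rw [AlgHom.coe_toLinearMap, this, htop]
        trivial
      obtain ⟨u, hu, hua⟩ := ha
      obtain ⟨c, hc⟩ := Ideal.mem_span_singleton'.1 (Ideal.Quotient.eq.1 hua.symm)
      exact ⟨u, hu, c, by rw [mul_comm, hc]; ring⟩
    have hzero : rootBSqProd n x p p = 0 := by
      have h := hrel p hpIcc
      rw [Finset.Icc_self, Finset.sum_singleton] at h
      have hbp := hb p hpIcc ∅ (Finset.empty_subset _)
      rw [Finset.sum_empty, add_zero] at hbp
      exact (smul_eq_zero_iff_right hbp).1 h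
    let N := 2 * (n - p) + 1
    let L : ℕ → A := fun t => if t < N then rootB n x p (w p (2 * n + 1 - p - t)) else x p
    have hLprod : ∀ s ≤ N, ∏ t ∈ Finset.range s, L t =
        ∏ t ∈ Finset.range s, rootB n x p (w p (2 * n + 1 - p - t)) := fun s hs =>
      Finset.prod_congr rfl fun t ht => if_pos ((Finset.mem_range.1 ht).trans_le hs)
    refine eq_top_of_forall_prod_mul_mem (N := N) (L := L)
      (U := Submodule.span ℝ (rootBProducts n w x (p + 1))) ?_ (fun t ht => hdecomp _ ?_)
      fun s hs u hu => ?_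
    · rw [Finset.prod_range_succ, hLprod N le_rfl, prod_range_perm_Icc hpn hwp, ← hzero,
        ← prod_rootB_mul_self n x hpn]
      simp [L]
    · by_cases htN : t < N
      · simp only [L, if_pos htN]
        refine rootB_eq_cases x (hwp _ ?_)
        simp only [Finset.mem_Icc, N] at htN ⊢
        omega
      · exact Or.inl (if_neg htN)
    · rw [hLprod s hs]
      refine (Submodule.span_le (p := Submodule.comap (LinearMap.mulLeft ℝ _)
        (Submodule.span ℝ (rootBProducts n w x p)))).2 (fun y hy => ?_) hu
      exact Submodule.subset_span (prod_mul_mem_rootBProducts hpn hs hy)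

theorem isHomogeneous_xv (n k : ℕ) : (xv n k).IsHomogeneous 1 := by
  unfold xv
  split_ifs
  · exact isHomogeneous_X _ _
  · exact isHomogeneous_zero _ _ _

theorem xv_fin_val_add_one {n : ℕ} (i : Fin n) : xv n (i.val + 1) = X i := by
  rw [xv, dif_pos ⟨by omega, i.isLt⟩]
  rfl

theorem isHomogeneous_rootBSqProd_xv (n i k : ℕ) :
    (rootBSqProd n (xv n) i k).IsHomogeneous (2 * (n - i) + 2) := by
  have h := ((isHomogeneous_xv n k).pow 2).mul (IsHomogeneous.prod (Finset.Icc (i + 1) n)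
    (fun j => xv n k ^ 2 - xv n j ^ 2) (fun _ => 1 * 2)
    fun j _ => ((isHomogeneous_xv n k).pow 2).sub ((isHomogeneous_xv n j).pow 2))
  have hdeg : 1 * 2 + ∑ _j ∈ Finset.Icc (i + 1) n, 1 * 2 = 2 * (n - i) + 2 := by
    simp only [Finset.sum_const, Nat.card_Icc, smul_eq_mul]
    omega
  rwa [hdeg] at h

theorem fBdef_eq_sum_rootBSqProd {n i : ℕ} (b : ℕ → ℕ → ℚ) (hi : i ≤ n) :
    fBdef n b i = ∑ k ∈ Finset.Icc 1 i, (b i k : ℝ) • rootBSqProd n (xv n) i k :=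
  Finset.sum_congr rfl fun k _ =>
    congrArg ((b i k : ℝ) • ·) (prod_rootB_mul_self n (xv n) hi k)

theorem isHomogeneous_fBdef {n i : ℕ} (b : ℕ → ℕ → ℚ) (hi : i ≤ n) :
    (fBdef n b i).IsHomogeneous (2 * (n - i) + 2) := by
  rw [fBdef_eq_sum_rootBSqProd b hi]
  refine IsHomogeneous.sum _ _ _ fun k _ => ?_
  rw [smul_eq_C_mul]
  exact (isHomogeneous_rootBSqProd_xv n i k).C_mul _

theorem IBdef_eq_span_range (n : ℕ) (b : ℕ → ℕ → ℚ) :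
    IBdef n b = Ideal.span (Set.range fun i : Fin n => fBdef n b (i.val + 1)) := by
  unfold IBdef
  congr 1
  ext y
  constructor
  · rintro ⟨i, hi, rfl⟩
    have h := Set.mem_Icc.1 hi
    exact ⟨⟨i - 1, by omega⟩, by simp [Nat.sub_add_cancel h.1]⟩
  · rintro ⟨i, rfl⟩
    exact ⟨i.val + 1, ⟨by omega, i.isLt⟩, rfl⟩

theorem prod_le_finrank_quotient_IBdef (n : ℕ) (b : ℕ → ℕ → ℚ)
    [Module.Finite ℝ (MvPolynomial (Fin n) ℝ ⧸ IBdef n b)] :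
    ∏ i : Fin n, (2 * (n - (i.val + 1)) + 2) ≤
      Module.finrank ℝ (MvPolynomial (Fin n) ℝ ⧸ IBdef n b) := by
  have h := IBdef_eq_span_range n b
  have : Module.Finite ℝ (MvPolynomial (Fin n) ℝ ⧸
      Ideal.span (Set.range fun i : Fin n => fBdef n b (i.val + 1))) := by
    rwa [← h]
  rw [h]
  exact prod_degree_le_finrank_quotient (fun _ => by omega) fun i => isHomogeneous_fBdef b i.isLt

/-- Finite dimensionality of the quotient forces the partial row sums of the coefficients to be
nonzero: otherwise the relations would hold on a linear subspace cut out by too few equations. -/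
theorem partialRowSumsNeZero_of_finite (n : ℕ) (b : ℕ → ℕ → ℚ)
    [Module.Finite ℝ (MvPolynomial (Fin n) ℝ ⧸ IBdef n b)] :
    PartialRowSumsNeZero n 1 (fun i k => (b i k : ℝ)) := by
  classical
  intro i hi s hs hsum
  rw [Finset.mem_Icc] at hi
  let F : ℕ → MvPolynomial (Fin n) ℝ := fun r =>
    if r < i then (if r ∈ s then xv n r - xv n i else xv n r)
    else if r = i then 0 else fBdef n b r
  let d : ℕ → ℕ := fun r => if r ≤ i then 1 else 2 * (n - r) + 2
  let J : Ideal (MvPolynomial (Fin n) ℝ) := Ideal.span (Set.range fun r : Fin n => F (r.val + 1))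
  have hd : ∀ r : Fin n, 0 < d (r.val + 1) := fun r => by
    simp only [d]
    split_ifs <;> omega
  have hF : ∀ r : Fin n, (F (r.val + 1)).IsHomogeneous (d (r.val + 1)) := fun r => by
    simp only [F, d]
    split_ifs
    any_goals omega
    · exact (isHomogeneous_xv _ _).sub (isHomogeneous_xv _ _)
    · exact isHomogeneous_xv _ _
    · exact isHomogeneous_zero _ _ _
    · exact isHomogeneous_fBdef b r.isLt
  let π := Ideal.Quotient.mkₐ ℝ J
  have hπF : ∀ r, 1 ≤ r → r ≤ n → π (F r) = 0 := fun r h1 h2 =>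
    Ideal.Quotient.eq_zero_iff_mem.2 (Ideal.subset_span
      ⟨⟨r - 1, by omega⟩, by simp [Nat.sub_add_cancel h1]⟩)
  have hmem : ∀ k ∈ s, π (xv n k) = π (xv n i) := fun k hk => by
    have hk' := Finset.mem_Ico.1 (hs hk)
    have h := hπF k hk'.1 (by omega)
    simp only [F, if_pos hk'.2, if_pos hk, map_sub] at h
    exact sub_eq_zero.1 h
  have hnot : ∀ k, 1 ≤ k → k < i → k ∉ s → π (xv n k) = 0 := fun k h1 h2 hk => by
    have h := hπF k h1 (by omega)
    simpa only [F, if_pos h2, if_neg hk] using h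
  have hle : IBdef n b ≤ J := by
    rw [IBdef_eq_span_range, Ideal.span_le]
    rintro _ ⟨r, rfl⟩
    refine Ideal.Quotient.eq_zero_iff_mem.1 (?_ : π (fBdef n b (r.val + 1)) = 0)
    have hrn : r.val + 1 ≤ n := r.isLt
    have h1r : 1 ≤ r.val + 1 := by omega
    generalize r.val + 1 = r at hrn h1r
    have hexp : π (fBdef n b r) =
        ∑ k ∈ Finset.Icc 1 r, (b r k : ℝ) • rootBSqProd n (fun k => π (xv n k)) r k := by
      rw [fBdef_eq_sum_rootBSqProd b hrn]
      simp only [map_sum, map_smul, ← RingHom.coe_coe π, map_rootBSqProd]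
    rcases lt_trichotomy r i with hri | rfl | hri
    · rw [hexp]
      refine Finset.sum_eq_zero fun k hk => ?_
      rw [Finset.mem_Icc] at hk
      by_cases hks : k ∈ s
      · rw [rootBSqProd_eq_zero_of_sq_eq (l := i) (Finset.mem_Icc.2 (by omega))
          (by simp only [hmem k hks]), smul_zero]
      · rw [rootBSqProd_eq_zero (hnot k hk.1 (by omega) hks), smul_zero]
    · have hterm : ∀ k ∈ Finset.Ico 1 r,
          (b r k : ℝ) • rootBSqProd n (fun k => π (xv n k)) r k =
            if k ∈ s then (b r k : ℝ) • rootBSqProd n (fun k => π (xv n k)) r r else 0 := by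
        intro k hk
        rw [Finset.mem_Ico] at hk
        split_ifs with hks
        · rw [rootBSqProd_eq_of_sq_eq (l := r) (by simp only [hmem k hks])]
        · rw [rootBSqProd_eq_zero (hnot k hk.1 hk.2 hks), smul_zero]
      rw [hexp, ← Finset.Ico_insert_right h1r, Finset.sum_insert (by simp),
        Finset.sum_congr rfl hterm, ← Finset.sum_filter, Finset.filter_mem_eq_inter,
        Finset.inter_eq_right.2 hs, ← Finset.sum_smul, ← add_smul, hsum, zero_smul]
    · have h := hπF r h1r hrn
      simpa only [F, if_neg hri.not_gt, if_neg hri.ne'] using h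
  have : Module.Finite ℝ (MvPolynomial (Fin n) ℝ ⧸ J) :=
    Module.Finite.of_surjective (Ideal.Quotient.factorₐ ℝ hle).toLinearMap
      (Ideal.Quotient.factor_surjective hle)
  refine ne_zero_of_finite_quotient hd hF ⟨i - 1, by omega⟩ ?_
  simp [F, Nat.sub_add_cancel hi.1]

theorem span_range_basB_eq_top (n : ℕ) (b : ℕ → ℕ → ℚ)
    [Module.Finite ℝ (MvPolynomial (Fin n) ℝ ⧸ IBdef n b)] {w : ℕ → Equiv.Perm ℕ}
    (hw : ∀ i ∈ Finset.Icc 1 n, ∀ j ∈ Finset.Icc (i + 1) (2 * n + 1 - i),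
      w i j ∈ Finset.Icc (i + 1) (2 * n + 1 - i)) :
    Submodule.span ℝ (Set.range (basB n b w)) = ⊤ := by
  let π := Ideal.Quotient.mkₐ ℝ (IBdef n b)
  have hπ : Function.Surjective π := Ideal.Quotient.mk_surjective
  have hgen : Algebra.adjoin ℝ ((fun k => π (xv n k)) '' Set.Icc 1 n) = ⊤ := by
    have h1 : Algebra.adjoin ℝ (π '' Set.range X) = ⊤ := by
      rw [← AlgHom.map_adjoin, adjoin_range_X, Algebra.map_top, AlgHom.range_eq_top]
      exact hπ
    refine eq_top_iff.2 (h1 ▸ Algebra.adjoin_mono ?_)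
    rintro _ ⟨_, ⟨i, rfl⟩, rfl⟩
    exact ⟨i.val + 1, ⟨by omega, i.isLt⟩, by simp only [xv_fin_val_add_one]⟩
  have hrel : ∀ i ∈ Finset.Icc 1 n, ∑ k ∈ Finset.Icc 1 i,
      (b i k : ℝ) • rootBSqProd n (fun k => π (xv n k)) i k = 0 := by
    intro i hi
    have h : π (fBdef n b i) = 0 :=
      Ideal.Quotient.eq_zero_iff_mem.2 (Ideal.subset_span ⟨i, Finset.mem_Icc.1 hi, rfl⟩)
    rw [fBdef_eq_sum_rootBSqProd b (Finset.mem_Icc.1 hi).2] at h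
    simpa only [map_sum, map_smul, ← RingHom.coe_coe π, map_rootBSqProd] using h
  rw [← top_le_iff, ← span_rootBProducts_eq_top hw n le_rfl (by omega)
    (partialRowSumsNeZero_of_finite n b) hgen hrel]
  refine Submodule.span_mono ?_
  rintro _ ⟨m, hm, rfl⟩
  refine ⟨fun i => ⟨m (i.val + 1), ?_⟩, ?_⟩
  · have := hm (i.val + 1) (Finset.mem_Icc.2 ⟨by omega, i.isLt⟩)
    omega
  · have hprod : ∀ G : ℕ → MvPolynomial (Fin n) ℝ ⧸ IBdef n b,
        ∏ i ∈ Finset.Icc 1 n, G i = ∏ i : Fin n, G (i.val + 1) := fun G => by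
      rw [Fin.prod_univ_eq_prod_range (fun i => G (i + 1)), Finset.range_eq_Ico,
        Finset.prod_Ico_add' G 0 n 1]
      rfl
    rw [hprod, basB, map_prod]
    refine Finset.prod_congr rfl fun i _ => ?_
    rw [map_prod]
    exact Finset.prod_congr rfl fun t _ => map_rootB (Ideal.Quotient.mk (IBdef n b)) n (xv n) _ _

/-- **Proposition 5.8.** If `R^{B}` is Artinian (finite dimensional over ℝ), then for any
choice of permutations `w⁽ⁱ⁾` of `{i+1,…,2n+1−i}`, the products
`∏_{i=1}^{n} α^{B}_{i,w⁽ⁱ⁾(2n+1−i)}···α^{B}_{i,w⁽ⁱ⁾(2n+1−i−m_i+1)}`,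
`0 ≤ m_i ≤ 2(n−i)+1`, form an ℝ-basis of `R^{B}`. -/
theorem stmt_5 (n : ℕ) (hn : 1 ≤ n) (b : ℕ → ℕ → ℚ)
    (hart : FiniteDimensional ℝ (MvPolynomial (Fin n) ℝ ⧸ IBdef n b))
    (w : ℕ → Equiv.Perm ℕ)
    (hw : ∀ i ∈ Finset.Icc 1 n, ∀ j ∈ Finset.Icc (i + 1) (2 * n + 1 - i),
      w i j ∈ Finset.Icc (i + 1) (2 * n + 1 - i)) :
    LinearIndependent ℝ (basB n b w) ∧
      Submodule.span ℝ (Set.range (basB n b w)) = ⊤ := by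
  have hspan := span_range_basB_eq_top n b hw
  refine ⟨linearIndependent_of_top_le_span_of_card_le_finrank hspan.ge ?_, hspan⟩
  simpa using prod_le_finrank_quotient_IBdef n b
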